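/- Let 0 < α₁ < α₂, set σ = (α₁+α₂)/(2α₂) and δ = κ₂/(8α₁), and let κ₂ > 0 satisfy κ₂ < 4α₁ and (α₁ − σα₂) + κ₂σ(2σδ + 1) < 0. Let (a₁,a₂) ∈ ℝ² and κ₁ ≥ 0. Set C₂ = 1, D = 1 + (α₂ + 2|a₂|)(α₂ − α₁)/α₂, C₃ = 1/(2D^δ), and define φ₂(x,y) = C₂(|x|^{2δ}+|y|^{2δ})/|y|^{2σδ}, φ₃(x,y) = C₃((Dx²+y²)/|y|^{2σ})^δ, U₂ = {x < −2, |x|^{−1/2} < |y| < 2}, U₃ = {x < −1/2, |y| > 1}. Let k : ℝ → ℝ be any C^∞ function with k(t) = 0 for t ≤ 0, k(t) = 1 for t ≥ 1, and k′(t) > 0 for t ∈ (0,1), and set ρ_{2,3}(x,y) = k(|y| − 1). Then the function φ_{2,3} on U₂ ∪ U₃, defined as φ₂ where |y| ≤ 1, as φ₃ where |y| ≥ 2, and as ρ_{2,3}φ₃ + (1−ρ_{2,3})φ₂ in between, is a Lyapunov function for L on U₂ ∪ U₃. -/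

import Mathlib

noncomputable def Lop (a₁ a₂ α₁ α₂ κ₁ κ₂ : ℝ) (Φ : ℝ × ℝ → ℝ) (p : ℝ × ℝ) : ℝ :=
  (a₁ * p.1 - α₁ * p.1 ^ 2 + p.2 ^ 2) * deriv (fun t => Φ (t, p.2)) p.1
    + (a₂ * p.2 - α₂ * p.1 * p.2) * deriv (fun t => Φ (p.1, t)) p.2
    + κ₁ * deriv (deriv (fun t => Φ (t, p.2))) p.1
    + κ₂ * deriv (deriv (fun t => Φ (p.1, t))) p.2

/-- `φ` is a Lyapunov function for the operator `L` (with the given parameters) on `U`: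
(I) `φ` is `C^∞` on `U`; (II) `φ z → ∞` as `|z| → ∞`, `z ∈ U`;
(III) there are `C, D > 0` with `Lφ ≤ -C•φ + D` on `U`. -/
def IsLyapunovOn (a₁ a₂ α₁ α₂ κ₁ κ₂ : ℝ) (φ : ℝ × ℝ → ℝ) (U : Set (ℝ × ℝ)) : Prop :=
  ContDiffOn ℝ (⊤ : ℕ∞) φ U ∧
    (∀ M : ℝ, ∃ R : ℝ, ∀ z ∈ U, R < ‖z‖ → M < φ z) ∧
    (∃ C > (0:ℝ), ∃ D > (0:ℝ), ∀ z ∈ U, Lop a₁ a₂ α₁ α₂ κ₁ κ₂ φ z ≤ -C * φ z + D)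
noncomputable def phi2 (σ δ : ℝ) (p : ℝ × ℝ) : ℝ :=
  1 * ((|p.1| ^ (2 * δ) + |p.2| ^ (2 * δ)) / |p.2| ^ (2 * σ * δ))

def U2 : Set (ℝ × ℝ) := {p : ℝ × ℝ | p.1 < -2 ∧ |p.1| ^ (-(1:ℝ)/2) < |p.2| ∧ |p.2| < 2}

noncomputable def phi3 (C₃ Dc σ δ : ℝ) (p : ℝ × ℝ) : ℝ :=
  C₃ * ((Dc * p.1 ^ 2 + p.2 ^ 2) / |p.2| ^ (2 * σ)) ^ δ

def U3 : Set (ℝ × ℝ) := {p : ℝ × ℝ | p.1 < -1/2 ∧ 1 < |p.2|}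

/-- The patched function `φ_{2,3}` built from a cutoff `k` via `ρ_{2,3}(x,y) = k(|y|-1)`. -/
noncomputable def phi23 (k : ℝ → ℝ) (C₃ Dc σ δ : ℝ) (p : ℝ × ℝ) : ℝ :=
  if |p.2| ≤ 1 then phi2 σ δ p
  else if 2 ≤ |p.2| then phi3 C₃ Dc σ δ p
  else k (|p.2| - 1) * phi3 C₃ Dc σ δ p + (1 - k (|p.2| - 1)) * phi2 σ δ p

set_option linter.unusedVariables false
set_option linter.unusedSimpArgs false

structure Jet (f fx fxx fy fyy : ℝ → ℝ → ℝ) : Prop where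
  dx : ∀ x y : ℝ, x < 0 → 0 < y → HasDerivAt (fun t => f t y) (fx x y) x
  dxx : ∀ x y : ℝ, x < 0 → 0 < y → HasDerivAt (fun t => fx t y) (fxx x y) x
  dy : ∀ x y : ℝ, x < 0 → 0 < y → HasDerivAt (fun t => f x t) (fy x y) y
  dyy : ∀ x y : ℝ, x < 0 → 0 < y → HasDerivAt (fun t => fy x t) (fyy x y) y

theorem Jet.lop {f fx fxx fy fyy : ℝ → ℝ → ℝ} (h : Jet f fx fxx fy fyy) {Φ : ℝ × ℝ → ℝ}
    (hΦ : ∀ x y : ℝ, x < 0 → 0 < y → Φ (x, y) = f x y) (a₁ a₂ α₁ α₂ κ₁ κ₂ : ℝ) (x y : ℝ)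
    (hx : x < 0) (hy : 0 < y) :
    Lop a₁ a₂ α₁ α₂ κ₁ κ₂ Φ (x, y) = (a₁ * x - α₁ * x ^ 2 + y ^ 2) * fx x y
      + (a₂ * y - α₂ * x * y) * fy x y + κ₁ * fxx x y + κ₂ * fyy x y := by
  have ex : ∀ x₀ y₀ : ℝ, x₀ < 0 → 0 < y₀ → deriv (fun t => Φ (t, y₀)) x₀ = fx x₀ y₀ := by
    intro x₀ y₀ hx₀ hy₀
    refine ((h.dx x₀ y₀ hx₀ hy₀).congr_of_eventuallyEq ?_).deriv
    filter_upwards [Iio_mem_nhds hx₀] with t ht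
    exact hΦ t y₀ ht hy₀
  have ey : ∀ x₀ y₀ : ℝ, x₀ < 0 → 0 < y₀ → deriv (fun t => Φ (x₀, t)) y₀ = fy x₀ y₀ := by
    intro x₀ y₀ hx₀ hy₀
    refine ((h.dy x₀ y₀ hx₀ hy₀).congr_of_eventuallyEq ?_).deriv
    filter_upwards [Ioi_mem_nhds hy₀] with t ht
    exact hΦ x₀ t hx₀ ht
  have exx : deriv (deriv (fun t => Φ (t, y))) x = fxx x y := by
    refine ((h.dxx x y hx hy).congr_of_eventuallyEq ?_).deriv
    filter_upwards [Iio_mem_nhds hx] with t ht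
    exact ex t y ht hy
  have eyy : deriv (deriv (fun t => Φ (x, t))) y = fyy x y := by
    refine ((h.dyy x y hx hy).congr_of_eventuallyEq ?_).deriv
    filter_upwards [Ioi_mem_nhds hy] with t ht
    exact ey x t hx ht
  simp only [Lop]
  rw [ex x y hx hy, ey x y hx hy, exx, eyy]

theorem Jet.exp {g gx gxx gy gyy : ℝ → ℝ → ℝ} (h : Jet g gx gxx gy gyy) :
    Jet (fun x y => Real.exp (g x y)) (fun x y => Real.exp (g x y) * gx x y)
      (fun x y => Real.exp (g x y) * (gxx x y + gx x y ^ 2))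
      (fun x y => Real.exp (g x y) * gy x y)
      (fun x y => Real.exp (g x y) * (gyy x y + gy x y ^ 2)) where
  dx x y hx hy := (h.dx x y hx hy).exp
  dy x y hx hy := (h.dy x y hx hy).exp
  dxx x y hx hy := by
    refine HasDerivAt.congr_deriv (((h.dx x y hx hy).exp).mul (h.dxx x y hx hy)) ?_
    ring
  dyy x y hx hy := by
    refine HasDerivAt.congr_deriv (((h.dy x y hx hy).exp).mul (h.dyy x y hx hy)) ?_
    ring

theorem Jet.add {f fx fxx fy fyy g gx gxx gy gyy : ℝ → ℝ → ℝ} (hf : Jet f fx fxx fy fyy)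
    (h : Jet g gx gxx gy gyy) :
    Jet (fun x y => f x y + g x y) (fun x y => fx x y + gx x y)
      (fun x y => fxx x y + gxx x y)
      (fun x y => fy x y + gy x y)
      (fun x y => fyy x y + gyy x y) where
  dx x y hx hy := (hf.dx x y hx hy).add (h.dx x y hx hy)
  dy x y hx hy := (hf.dy x y hx hy).add (h.dy x y hx hy)
  dxx x y hx hy := (hf.dxx x y hx hy).add (h.dxx x y hx hy)
  dyy x y hx hy := (hf.dyy x y hx hy).add (h.dyy x y hx hy)

theorem Jet.mix {f fx fxx fy fyy g gx gxx gy gyy : ℝ → ℝ → ℝ} (hf : Jet f fx fxx fy fyy)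
    (h : Jet g gx gxx gy gyy) (r r' r'' : ℝ → ℝ) (hr : ∀ t, HasDerivAt r (r' t) t)
    (hr' : ∀ t, HasDerivAt r' (r'' t) t) :
    Jet (fun x y => r y * f x y + (1 - r y) * g x y)
      (fun x y => r y * fx x y + (1 - r y) * gx x y)
      (fun x y => r y * fxx x y + (1 - r y) * gxx x y)
      (fun x y => r' y * (f x y - g x y) + (r y * fy x y + (1 - r y) * gy x y))
      (fun x y => r'' y * (f x y - g x y) + 2 * (r' y * (fy x y - gy x y)) +
        (r y * fyy x y + (1 - r y) * gyy x y)) where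
  dx x y hx hy := ((hf.dx x y hx hy).const_mul _).add ((h.dx x y hx hy).const_mul _)
  dxx x y hx hy := ((hf.dxx x y hx hy).const_mul _).add ((h.dxx x y hx hy).const_mul _)
  dy x y hx hy := by
    refine HasDerivAt.congr_deriv (((hr y).mul (hf.dy x y hx hy)).add (((hr y).const_sub 1).mul (h.dy x y hx hy))) ?_
    ring
  dyy x y hx hy := by
    refine HasDerivAt.congr_deriv (((hr' y).mul ((hf.dy x y hx hy).sub (h.dy x y hx hy))).add 
      (((hr y).mul (hf.dyy x y hx hy)).add 
        (((hr y).const_sub 1).mul (h.dyy x y hx hy)))) ?_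
    simp only [Pi.sub_apply]
    ring

theorem jetL (p q : ℝ) : Jet (fun x y => p * Real.log x + q * Real.log y)
    (fun x y => p * x⁻¹) (fun x y => p * (-(x ^ 2)⁻¹)) (fun x y => q * y⁻¹)
    (fun x y => q * (-(y ^ 2)⁻¹)) where
  dx x y hx hy := ((Real.hasDerivAt_log hx.ne).const_mul p).add_const _
  dy x y hx hy := ((Real.hasDerivAt_log hy.ne').const_mul q).const_add _
  dxx x y hx hy := (hasDerivAt_inv hx.ne).const_mul p
  dyy x y hx hy := (hasDerivAt_inv hy.ne').const_mul q

theorem jetP (c D δ q : ℝ) (hD : 0 < D) :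
    Jet (fun x y => c + δ * Real.log (D * x ^ 2 + y ^ 2) + q * Real.log y)
    (fun x y => δ * (2 * D * x / (D * x ^ 2 + y ^ 2)))
    (fun x y => δ * (2 * D / (D * x ^ 2 + y ^ 2) - (2 * D * x / (D * x ^ 2 + y ^ 2)) ^ 2))
    (fun x y => δ * (2 * y / (D * x ^ 2 + y ^ 2)) + q * y⁻¹)
    (fun x y => δ * (2 / (D * x ^ 2 + y ^ 2) - (2 * y / (D * x ^ 2 + y ^ 2)) ^ 2)
      + q * (-(y ^ 2)⁻¹)) := by
  have hQ : ∀ x y : ℝ, 0 < y → D * x ^ 2 + y ^ 2 ≠ 0 := by intro x y hy; positivity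
  have hQx : ∀ x y : ℝ, HasDerivAt (fun t => D * t ^ 2 + y ^ 2) (2 * D * x) x := by
    intro x y
    refine HasDerivAt.congr_deriv ((((hasDerivAt_id x).pow 2).const_mul D).add_const (y ^ 2)) ?_
    simp <;> ring
  have hQy : ∀ x y : ℝ, HasDerivAt (fun t => D * x ^ 2 + t ^ 2) (2 * y) y := by
    intro x y
    refine HasDerivAt.congr_deriv (((hasDerivAt_id y).pow 2).const_add (D * x ^ 2)) ?_
    simp
  have hlx : ∀ x y : ℝ, HasDerivAt (fun t => 2 * D * t) (2 * D) x := by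
    intro x y
    simpa using (hasDerivAt_id x).const_mul (2 * D)
  have hly : ∀ y : ℝ, HasDerivAt (fun t : ℝ => 2 * t) 2 y := by
    intro y
    simpa using (hasDerivAt_id y).const_mul (2 : ℝ)
  refine ⟨fun x y hx hy => ?_, fun x y hx hy => ?_, fun x y hx hy => ?_, fun x y hx hy => ?_⟩
  · exact ((((hQx x y).log (hQ x y hy)).const_mul δ).const_add c).add_const _
  · refine HasDerivAt.congr_deriv (((hlx x y).div (hQx x y) (hQ x y hy)).const_mul δ) ?_
    have := hQ x y hy
    field_simp
  · exact ((((hQy x y).log (hQ x y hy)).const_mul δ).const_add c).add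
      ((Real.hasDerivAt_log hy.ne').const_mul q)
  · refine HasDerivAt.congr_deriv ((((hly y).div (hQy x y) (hQ x y hy)).const_mul δ).add 
      ((hasDerivAt_inv hy.ne').const_mul q)) ?_
    have := hQ x y hy
    have e : δ * ((2 * (D * x ^ 2 + y ^ 2) - 2 * y * (2 * y)) / (D * x ^ 2 + y ^ 2) ^ 2)
        = δ * (2 / (D * x ^ 2 + y ^ 2) - (2 * y / (D * x ^ 2 + y ^ 2)) ^ 2) := by
      field_simp
    rw [← e]

set_option maxHeartbeats 1000000 in
theorem estP (a₁ a₂ α₁ α₂ κ₁ κ₂ σ δ D : ℝ) (hα : α₁ < α₂)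
    (hσ0 : 0 < σ) (hσ1 : σ < 1) (hσα : 2 * σ * α₂ = α₁ + α₂)
    (hδ0 : 0 < δ) (hδ1 : δ < 1 / 2) (hκ₂ : 0 < κ₂) (hκ₁ : 0 ≤ κ₁)
    (hD : D = 1 + (α₂ - α₁) + 4 * |a₂| * (1 - σ)) :
    ∃ c > 0, ∃ R ≥ 2, ∀ x y : ℝ, x < -1/2 → 1 < y → (x < -R ∨ R < y) →
      (a₁ * x - α₁ * x ^ 2 + y ^ 2) * (δ * (2 * D * x / (D * x ^ 2 + y ^ 2)))
      + (a₂ * y - α₂ * x * y) * (δ * (2 * y / (D * x ^ 2 + y ^ 2)) + -(2 * σ * δ) * y⁻¹)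
      + κ₁ * (δ * (2 * D / (D * x ^ 2 + y ^ 2) - (2 * D * x / (D * x ^ 2 + y ^ 2)) ^ 2)
          + (δ * (2 * D * x / (D * x ^ 2 + y ^ 2))) ^ 2)
      + κ₂ * (δ * (2 / (D * x ^ 2 + y ^ 2) - (2 * y / (D * x ^ 2 + y ^ 2)) ^ 2)
          + -(2 * σ * δ) * (-(y ^ 2)⁻¹)
          + (δ * (2 * y / (D * x ^ 2 + y ^ 2)) + -(2 * σ * δ) * y⁻¹) ^ 2) ≤ c * x := by
  have hσδ : 2 * σ * δ ≤ 1 := by nlinarith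
  have hD1 : 1 ≤ D := by
    have : 0 ≤ 4 * |a₂| * (1 - σ) := mul_nonneg (by positivity) (by linarith)
    linarith
  set s := α₂ - α₁ with hs
  have hs0 : 0 < s := by linarith
  set c₁ := min s 2 with hc₁
  have hc₁0 : 0 < c₁ := lt_min hs0 two_pos
  have hc₁s : c₁ ≤ s := min_le_left _ _
  have hc₁2 : c₁ ≤ 2 := min_le_right _ _
  set c₂ := |2 * D * (a₁ - σ * a₂)| with hc₂
  set K := 2 * D * κ₁ + 8 * κ₂ with hK
  have hK0 : 0 < K := by positivity
  set c := δ * c₁ / (3 * D) with hc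
  have hc0 : 0 < c := by positivity
  refine ⟨c, hc0, 2 + δ * c₂ / c + 2 * K / c, ?_, ?_⟩
  · have : 0 ≤ δ * c₂ / c + 2 * K / c := by positivity
    linarith
  intro x y hx hy hR
  obtain ⟨u, rfl⟩ : ∃ u, x = -u := ⟨-x, by ring⟩
  set R := 2 + δ * c₂ / c + 2 * K / c with hRdef
  have hR2 : 2 ≤ R := by
    have : 0 ≤ δ * c₂ / c + 2 * K / c := by positivity
    linarith
  have hRc2 : δ * c₂ ≤ c * R := by
    have : c * R = 2 * c + δ * c₂ + 2 * K := by rw [hRdef]; field_simp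
    linarith
  have hRK : 2 * K ≤ c * R := by
    have : c * R = 2 * c + δ * c₂ + 2 * K := by rw [hRdef]; field_simp
    have : 0 ≤ δ * c₂ := by positivity
    linarith
  have hu : 1 / 2 < u := by linarith
  have hu0 : 0 < u := by linarith
  have hy0 : 0 < y := by linarith
  set Q := D * (-u) ^ 2 + y ^ 2 with hQ
  have hQ' : Q = D * u ^ 2 + y ^ 2 := by rw [hQ]; ring
  have hQy : y ^ 2 ≤ Q := by rw [hQ']; have := mul_nonneg (by linarith : (0:ℝ) ≤ D) (sq_nonneg u); linarith
  have hQ0 : 0 < Q := lt_of_lt_of_le (by positivity) hQy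
  have hQuy : u ^ 2 + y ^ 2 ≤ Q := by rw [hQ']; have := mul_le_mul_of_nonneg_right hD1 (sq_nonneg u); linarith
  have hQuy' : Q ≤ D * (u ^ 2 + y ^ 2) := by rw [hQ']; have := mul_le_mul_of_nonneg_right hD1 (sq_nonneg y); linarith
  -- first-order part
  set N := 2 * D * (-u) * (a₁ * (-u) - α₁ * (-u) ^ 2 + y ^ 2) + 2 * y ^ 2 * (a₂ - α₂ * (-u))
    - 2 * σ * (a₂ - α₂ * (-u)) * Q with hN
  have hfirst : (a₁ * (-u) - α₁ * (-u) ^ 2 + y ^ 2) * (δ * (2 * D * (-u) / Q))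
      + (a₂ * y - α₂ * (-u) * y) * (δ * (2 * y / Q) + -(2 * σ * δ) * y⁻¹) = δ * (N / Q) := by
    rw [hN]; field_simp; ring
  have hNle : N ≤ -c₁ * u * (u ^ 2 + y ^ 2) + c₂ * u ^ 2 := by
    have e : N = - D * s * u ^ 3 + (-2 * D + s) * (u * y ^ 2) + (2 * D * (a₁ - σ * a₂)) * u ^ 2
        + 2 * (1 - σ) * a₂ * y ^ 2 := by
      rw [hN, hQ', hs]
      have : α₁ = 2 * σ * α₂ - α₂ := by linarith
      rw [this]; ring
    have h1 : c₁ * u ^ 3 ≤ D * s * u ^ 3 := by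
      apply mul_le_mul_of_nonneg_right _ (by positivity)
      have h8 := mul_le_mul_of_nonneg_right hD1 hs0.le
      linarith
    have h2 : (2 * D * (a₁ - σ * a₂)) * u ^ 2 ≤ c₂ * u ^ 2 :=
      mul_le_mul_of_nonneg_right (le_abs_self _) (by positivity)
    have h3 : (-2 * D + s) * (u * y ^ 2) ≤ -c₁ * (u * y ^ 2) - 8 * |a₂| * (1 - σ) * (u * y ^ 2) := by
      rw [← sub_mul]
      apply mul_le_mul_of_nonneg_right _ (by positivity)
      rw [hD]; linarith
    have h4 : 2 * (1 - σ) * a₂ * y ^ 2 ≤ 8 * |a₂| * (1 - σ) * (u * y ^ 2) := by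
      have h5 : 2 * (1 - σ) * a₂ * y ^ 2 ≤ 2 * (1 - σ) * |a₂| * y ^ 2 := by
        apply mul_le_mul_of_nonneg_right _ (by positivity)
        exact mul_le_mul_of_nonneg_left (le_abs_self _) (by linarith)
      have h6 : 0 ≤ (1 - σ) * |a₂| * y ^ 2 :=
        mul_nonneg (mul_nonneg (by linarith) (abs_nonneg _)) (by positivity)
      have h7 := mul_le_mul_of_nonneg_left hu.le h6
      linarith
    rw [e]; linarith
  have hfirst2 : δ * (N / Q) ≤ - 3 * c * u + c * u := by
    have hA : N / Q ≤ (-c₁ * u * (u ^ 2 + y ^ 2) + c₂ * u ^ 2) / Q :=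
      div_le_div_of_nonneg_right hNle hQ0.le
    have hB : δ * (-c₁ * u * (u ^ 2 + y ^ 2)) ≤ -3 * c * u * Q := by
      have : 3 * c * D = δ * c₁ := by rw [hc]; field_simp
      have h2 : 3 * c * u * Q ≤ 3 * c * u * (D * (u ^ 2 + y ^ 2)) :=
        mul_le_mul_of_nonneg_left hQuy' (by positivity)
      have h3 : 3 * c * u * (D * (u ^ 2 + y ^ 2)) = δ * c₁ * (u * (u ^ 2 + y ^ 2)) := by
        rw [← this]; ring
      linarith
    have hRu : R * u ≤ u ^ 2 + y ^ 2 := by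
      by_cases h : R ≤ u
      · have := mul_le_mul_of_nonneg_right h hu0.le
        have := sq_nonneg y
        linarith
      · rcases hR with h' | h'
        · linarith
        · have := mul_le_mul h'.le ((not_le.1 h).le.trans h'.le) hu0.le hy0.le
          have := sq_nonneg u
          linarith
    have hC : δ * (c₂ * u ^ 2) ≤ c * u * Q := by
      calc δ * (c₂ * u ^ 2) = (δ * c₂) * u ^ 2 := by ring
        _ ≤ c * R * u ^ 2 := mul_le_mul_of_nonneg_right hRc2 (by positivity)
        _ = c * u * (R * u) := by ring
        _ ≤ c * u * Q := mul_le_mul_of_nonneg_left (hRu.trans hQuy) (by positivity)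
    calc δ * (N / Q) ≤ δ * ((-c₁ * u * (u ^ 2 + y ^ 2) + c₂ * u ^ 2) / Q) :=
          mul_le_mul_of_nonneg_left hA hδ0.le
      _ = (δ * (-c₁ * u * (u ^ 2 + y ^ 2)) + δ * (c₂ * u ^ 2)) / Q := by ring
      _ ≤ - 3 * c * u + c * u := by
        rw [div_le_iff₀ hQ0]; linarith
  -- second-order part
  have hyi : 1 / Q ≤ (y ^ 2)⁻¹ := by
    rw [one_div]; exact inv_anti₀ (by positivity) hQy
  have hyi0 : 0 < (y ^ 2)⁻¹ := by positivity
  have hxx : κ₁ * (δ * (2 * D / Q - (2 * D * (-u) / Q) ^ 2) + (δ * (2 * D * (-u) / Q)) ^ 2)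
      ≤ 2 * D * κ₁ * (y ^ 2)⁻¹ := by
    have h1 : δ * (2 * D / Q - (2 * D * (-u) / Q) ^ 2) + (δ * (2 * D * (-u) / Q)) ^ 2
        ≤ 2 * D * (y ^ 2)⁻¹ := by
      have h2 : 2 * D / Q ≤ 2 * D * (y ^ 2)⁻¹ := by
        rw [div_eq_mul_one_div]; exact mul_le_mul_of_nonneg_left hyi (by positivity)
      have h3 : 0 ≤ 2 * D / Q := by positivity
      have h4 := sq_nonneg (2 * D * (-u) / Q)
      have h5 := mul_nonneg (mul_nonneg hδ0.le (by linarith : 0 ≤ 1 - δ)) h4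
      have h6 : δ * (2 * D / Q) ≤ 2 * D / Q := mul_le_of_le_one_left h3 (by linarith)
      generalize 2 * D / Q = t1 at *
      generalize 2 * D * (-u) / Q = t2 at *
      linarith
    calc _ ≤ κ₁ * (2 * D * (y ^ 2)⁻¹) := mul_le_mul_of_nonneg_left h1 hκ₁
      _ = _ := by ring
  have hyy : κ₂ * (δ * (2 / Q - (2 * y / Q) ^ 2) + -(2 * σ * δ) * (-(y ^ 2)⁻¹)
          + (δ * (2 * y / Q) + -(2 * σ * δ) * y⁻¹) ^ 2) ≤ 8 * κ₂ * (y ^ 2)⁻¹ := by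
    have h1 : δ * (2 / Q - (2 * y / Q) ^ 2) ≤ (y ^ 2)⁻¹ := by
      have h2 : 2 / Q ≤ 2 * (y ^ 2)⁻¹ := by
        rw [div_eq_mul_one_div]; exact mul_le_mul_of_nonneg_left hyi (by positivity)
      have h4 := sq_nonneg (2 * y / Q)
      have h5 := mul_nonneg hδ0.le h4
      have h6 : δ * (2 / Q) ≤ 1 / 2 * (2 / Q) :=
        mul_le_mul_of_nonneg_right hδ1.le (by positivity)
      rw [mul_sub]
      linarith
    have h2 : -(2 * σ * δ) * (-(y ^ 2)⁻¹) ≤ (y ^ 2)⁻¹ := by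
      have := mul_le_mul_of_nonneg_right hσδ hyi0.le
      linarith
    have h3 : (δ * (2 * y / Q) + -(2 * σ * δ) * y⁻¹) ^ 2 ≤ (y ^ 2)⁻¹ := by
      rw [← inv_pow]
      have h5 : 0 ≤ y⁻¹ := by positivity
      have h6 : y / Q ≤ y⁻¹ := by
        rw [div_le_iff₀ hQ0]
        calc y = y⁻¹ * y ^ 2 := by field_simp
          _ ≤ y⁻¹ * Q := mul_le_mul_of_nonneg_left hQy h5
      have h7 : 0 ≤ y / Q := by positivity
      have h8 : 2 * y / Q = 2 * (y / Q) := by ring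
      rw [h8]
      apply sq_le_sq'
      · have h9 := mul_nonneg hδ0.le h7
        have h10 := mul_le_mul_of_nonneg_right hσδ h5
        linarith
      · have h9 := mul_le_mul_of_nonneg_right hδ1.le h7
        have : 0 ≤ 2 * σ * δ * y⁻¹ := by positivity
        linarith
    calc _ ≤ κ₂ * (8 * (y ^ 2)⁻¹) := mul_le_mul_of_nonneg_left (by linarith) hκ₂.le
      _ = _ := by ring
  have hKy : K * (y ^ 2)⁻¹ ≤ c * u := by
    rw [← div_eq_mul_inv, div_le_iff₀ (by positivity)]
    rcases hR with h | h
    · have h1 : c * R ≤ c * u := mul_le_mul_of_nonneg_left (by linarith) hc0.le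
      have h2 : c * u * 1 ≤ c * u * y ^ 2 :=
        mul_le_mul_of_nonneg_left (one_le_pow₀ hy.le) (by positivity)
      linarith
    · have h1 : R ≤ y ^ 2 := h.le.trans (le_self_pow₀ hy.le two_ne_zero)
      have h2 : c * u * R ≤ c * u * y ^ 2 := mul_le_mul_of_nonneg_left h1 (by positivity)
      have h3 : 1 / 2 * (c * R) ≤ u * (c * R) := mul_le_mul_of_nonneg_right hu.le (by positivity)
      linarith
  have hKK : K * (y ^ 2)⁻¹ = 2 * D * κ₁ * (y ^ 2)⁻¹ + 8 * κ₂ * (y ^ 2)⁻¹ := by rw [hK]; ring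
  linarith

set_option maxHeartbeats 1000000 in
theorem estA (a₁ a₂ α₁ α₂ κ₁ κ₂ σ δ : ℝ) (hα₂ : 0 < α₂)
    (hσ0 : 0 < σ) (hσ1 : σ < 1)
    (hδ0 : 0 < δ) (hδ1 : δ < 1 / 2) (hκ₂ : 0 < κ₂) (hκ₁ : 0 ≤ κ₁)
    (hneg : (α₁ - σ * α₂) + κ₂ * σ * (2 * σ * δ + 1) < 0) :
    ∃ c > 0, ∃ R ≥ 2, ∀ x y eA eB : ℝ, x < -R → 0 < y → y < 2 → (y ^ 2)⁻¹ < -x → 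
      0 < eA → 0 < eB → eB = eA * Real.exp (2 * δ * (Real.log y - Real.log x)) →
      (a₁ * x - α₁ * x ^ 2 + y ^ 2) * (eA * (2 * δ * x⁻¹) + eB * (0 * x⁻¹))
      + (a₂ * y - α₂ * x * y) * (eA * (-(2 * σ * δ) * y⁻¹) + eB * (2 * δ * (1 - σ) * y⁻¹))
      + κ₁ * (eA * (2 * δ * (-(x ^ 2)⁻¹) + (2 * δ * x⁻¹) ^ 2)
          + eB * (0 * (-(x ^ 2)⁻¹) + (0 * x⁻¹) ^ 2))
      + κ₂ * (eA * (-(2 * σ * δ) * (-(y ^ 2)⁻¹) + (-(2 * σ * δ) * y⁻¹) ^ 2)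
          + eB * (2 * δ * (1 - σ) * (-(y ^ 2)⁻¹) + (2 * δ * (1 - σ) * y⁻¹) ^ 2)) ≤ c * x * eA := by
  set m := -((α₁ - σ * α₂) + κ₂ * σ * (2 * σ * δ + 1)) with hm
  have hm0 : 0 < m := by linarith
  set c₀ := |a₁ - σ * a₂| with hc₀
  set K := 2 * δ * (1 - σ) * (|a₂| + α₂) with hK
  have h1σ : 0 < 1 - σ := by linarith
  have hK0 : 0 < K := by positivity
  set ε := δ * m / (2 * K) with hε
  have hε0 : 0 < ε := by positivity
  set T := Real.log 2 - Real.log ε / (2 * δ) with hT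
  refine ⟨δ * m / 2, by positivity, 2 + 2 * c₀ / m + Real.exp T, ?_, ?_⟩
  · have : 0 ≤ 2 * c₀ / m + Real.exp T := by positivity
    linarith
  intro x y eA eB hx hy hy2 hyx hA hB hAB
  obtain ⟨u, rfl⟩ : ∃ u, x = -u := ⟨-x, by ring⟩
  have hc0m : 0 ≤ 2 * c₀ / m := by positivity
  have hu2 : 2 < u := by have := Real.exp_pos T; linarith
  have hu0 : 0 < u := by linarith
  have hum : 2 * c₀ ≤ m * u := by
    have h1 : 2 * c₀ / m ≤ u := by have := Real.exp_pos T; linarith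
    rw [div_le_iff₀ hm0] at h1; linarith
  have huT : T ≤ Real.log u := by
    rw [Real.le_log_iff_exp_le hu0]; linarith
  have hlx : Real.log (-u) = Real.log u := Real.log_neg_eq_log u
  rw [hlx] at hAB
  have hBε : eB ≤ eA * ε := by
    rw [hAB]
    apply mul_le_mul_of_nonneg_left _ hA.le
    rw [← Real.le_log_iff_exp_le hε0]
    have h1 : Real.log y ≤ Real.log 2 := Real.log_le_log hy hy2.le
    have h2 : Real.log y - Real.log u ≤ Real.log ε / (2 * δ) := by linarith
    calc 2 * δ * (Real.log y - Real.log u) ≤ 2 * δ * (Real.log ε / (2 * δ)) :=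
          mul_le_mul_of_nonneg_left h2 (by positivity)
      _ = Real.log ε := by field_simp
  have hyi0 : 0 < (y ^ 2)⁻¹ := by positivity
  set w := (y ^ 2)⁻¹ with hw
  have hEA : (a₁ * (-u) - α₁ * (-u) ^ 2 + y ^ 2) * (2 * δ * (-u)⁻¹)
      + (a₂ * y - α₂ * (-u) * y) * (-(2 * σ * δ) * y⁻¹)
      + κ₁ * (2 * δ * (-((-u) ^ 2)⁻¹) + (2 * δ * (-u)⁻¹) ^ 2)
      + κ₂ * (-(2 * σ * δ) * (-w) + (-(2 * σ * δ) * y⁻¹) ^ 2) ≤ - (δ * m * u) := by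
    have e1 : (a₁ * (-u) - α₁ * (-u) ^ 2 + y ^ 2) * (2 * δ * (-u)⁻¹)
      + (a₂ * y - α₂ * (-u) * y) * (-(2 * σ * δ) * y⁻¹)
      = 2 * δ * ((a₁ - σ * a₂) + (α₁ - σ * α₂) * u) - 2 * δ * (y ^ 2 / u) := by
      rw [inv_neg]; field_simp; ring
    have e2 : 2 * δ * (-((-u) ^ 2)⁻¹) + (2 * δ * (-u)⁻¹) ^ 2 = - (2 * δ * (1 - 2 * δ) * (u ^ 2)⁻¹) := by
      rw [inv_neg, neg_sq]; field_simp; ring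
    have e3 : -(2 * σ * δ) * (-w) + (-(2 * σ * δ) * y⁻¹) ^ 2
        = 2 * δ * (σ * (2 * σ * δ + 1)) * w := by
      rw [hw]; field_simp; ring
    have h2 : 0 ≤ 2 * δ * (1 - 2 * δ) * (u ^ 2)⁻¹ :=
      mul_nonneg (mul_nonneg (by linarith) (by linarith)) (by positivity)
    have h3 : κ₂ * (2 * δ * (σ * (2 * σ * δ + 1)) * w) ≤ κ₂ * (2 * δ * (σ * (2 * σ * δ + 1)) * u) := by
      apply mul_le_mul_of_nonneg_left _ hκ₂.le
      apply mul_le_mul_of_nonneg_left _ (by positivity)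
      linarith
    have h4 : 0 ≤ 2 * δ * (y ^ 2 / u) := by positivity
    have h5 : 0 ≤ κ₁ * (2 * δ * (1 - 2 * δ) * (u ^ 2)⁻¹) := mul_nonneg hκ₁ h2
    have h6 : δ * (2 * (a₁ - σ * a₂)) ≤ δ * (m * u) := by
      apply mul_le_mul_of_nonneg_left _ hδ0.le
      have := le_abs_self (a₁ - σ * a₂)
      linarith
    rw [e1, e2, e3]
    have h7 : 2 * δ * ((α₁ - σ * α₂) * u) + κ₂ * (2 * δ * (σ * (2 * σ * δ + 1)) * u) = - (2 * δ * m * u) := by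
      rw [hm]; ring
    linarith
  have hEB : (a₂ * y - α₂ * (-u) * y) * (2 * δ * (1 - σ) * y⁻¹)
      + κ₂ * (2 * δ * (1 - σ) * (-w) + (2 * δ * (1 - σ) * y⁻¹) ^ 2) ≤ K * u := by
    have e1 : (a₂ * y - α₂ * (-u) * y) * (2 * δ * (1 - σ) * y⁻¹) = 2 * δ * (1 - σ) * (a₂ + α₂ * u) := by
      field_simp; ring
    have e2 : 2 * δ * (1 - σ) * (-w) + (2 * δ * (1 - σ) * y⁻¹) ^ 2
        = - (2 * δ * (1 - σ) * (1 - 2 * δ * (1 - σ)) * w) := by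
      rw [hw]; field_simp; ring
    have h1 : 2 * δ * (1 - σ) ≤ 1 := mul_le_one₀ (by linarith) (by linarith) (by linarith)
    have h2 : 0 ≤ 2 * δ * (1 - σ) * (1 - 2 * δ * (1 - σ)) * w :=
      mul_nonneg (mul_nonneg (by positivity) (by linarith)) hyi0.le
    have h3 := mul_nonneg hκ₂.le h2
    have h4 : 2 * δ * (1 - σ) * (a₂ + α₂ * u) ≤ 2 * δ * (1 - σ) * ((|a₂| + α₂) * u) := by
      apply mul_le_mul_of_nonneg_left _ (by positivity)
      have := le_abs_self a₂
      have h7 := mul_le_mul_of_nonneg_left (by linarith : 1 ≤ u) (abs_nonneg a₂)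
      linarith
    rw [e1, e2]
    have : 2 * δ * (1 - σ) * ((|a₂| + α₂) * u) = K * u := by rw [hK]; ring
    linarith
  have hKε : K * ε = δ * m / 2 := by rw [hε]; field_simp
  have f1 := mul_le_mul_of_nonneg_left hEA hA.le
  have f2 := mul_le_mul_of_nonneg_left hEB hB.le
  have f3 : eB * (K * u) ≤ eA * ε * (K * u) := mul_le_mul_of_nonneg_right hBε (by positivity)
  have f4 : eA * ε * (K * u) = δ * m / 2 * u * eA := by rw [← hKε]; ring
  have f5 : δ * m / 2 * (-u) * eA = eA * (-(δ * m * u)) + δ * m / 2 * u * eA := by ring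
  rw [f5]
  refine le_trans (le_of_eq ?_) (add_le_add f1 (f2.trans (f3.trans f4.le)))
  ring

structure JetC (f fx fxx fy fyy : ℝ → ℝ → ℝ) (S : Set (ℝ × ℝ)) : Prop where
  c : ContinuousOn (fun p : ℝ × ℝ => f p.1 p.2) S
  cx : ContinuousOn (fun p : ℝ × ℝ => fx p.1 p.2) S
  cxx : ContinuousOn (fun p : ℝ × ℝ => fxx p.1 p.2) S
  cy : ContinuousOn (fun p : ℝ × ℝ => fy p.1 p.2) S
  cyy : ContinuousOn (fun p : ℝ × ℝ => fyy p.1 p.2) S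

theorem JetC.exp {g gx gxx gy gyy : ℝ → ℝ → ℝ} {S : Set (ℝ × ℝ)} (h : JetC g gx gxx gy gyy S) :
    JetC (fun x y => Real.exp (g x y)) (fun x y => Real.exp (g x y) * gx x y)
      (fun x y => Real.exp (g x y) * (gxx x y + gx x y ^ 2))
      (fun x y => Real.exp (g x y) * gy x y)
      (fun x y => Real.exp (g x y) * (gyy x y + gy x y ^ 2)) S where
  c := h.c.rexp
  cx := h.c.rexp.mul h.cx
  cxx := h.c.rexp.mul (h.cxx.add (h.cx.pow 2))
  cy := h.c.rexp.mul h.cy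
  cyy := h.c.rexp.mul (h.cyy.add (h.cy.pow 2))

theorem JetC.add {f fx fxx fy fyy g gx gxx gy gyy : ℝ → ℝ → ℝ} {S : Set (ℝ × ℝ)}
    (hf : JetC f fx fxx fy fyy S) (h : JetC g gx gxx gy gyy S) :
    JetC (fun x y => f x y + g x y) (fun x y => fx x y + gx x y)
      (fun x y => fxx x y + gxx x y)
      (fun x y => fy x y + gy x y)
      (fun x y => fyy x y + gyy x y) S where
  c := hf.c.add h.c
  cx := hf.cx.add h.cx
  cxx := hf.cxx.add h.cxx
  cy := hf.cy.add h.cy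
  cyy := hf.cyy.add h.cyy

theorem JetC.mix {f fx fxx fy fyy g gx gxx gy gyy : ℝ → ℝ → ℝ} {S : Set (ℝ × ℝ)}
    (hf : JetC f fx fxx fy fyy S) (h : JetC g gx gxx gy gyy S) (r r' r'' : ℝ → ℝ)
    (hr : Continuous r) (hr' : Continuous r') (hr'' : Continuous r'') :
    JetC (fun x y => r y * f x y + (1 - r y) * g x y)
      (fun x y => r y * fx x y + (1 - r y) * gx x y)
      (fun x y => r y * fxx x y + (1 - r y) * gxx x y)
      (fun x y => r' y * (f x y - g x y) + (r y * fy x y + (1 - r y) * gy x y))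
      (fun x y => r'' y * (f x y - g x y) + 2 * (r' y * (fy x y - gy x y)) +
        (r y * fyy x y + (1 - r y) * gyy x y)) S := by
  have c1 : ContinuousOn (fun p : ℝ × ℝ => r p.2) S := (hr.comp continuous_snd).continuousOn
  have c2 : ContinuousOn (fun p : ℝ × ℝ => r' p.2) S := (hr'.comp continuous_snd).continuousOn
  have c3 : ContinuousOn (fun p : ℝ × ℝ => r'' p.2) S := (hr''.comp continuous_snd).continuousOn
  have c4 : ContinuousOn (fun p : ℝ × ℝ => 1 - r p.2) S := continuousOn_const.sub c1
  exact ⟨(c1.mul hf.c).add (c4.mul h.c), (c1.mul hf.cx).add (c4.mul h.cx),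
    (c1.mul hf.cxx).add (c4.mul h.cxx),
    (c2.mul (hf.c.sub h.c)).add ((c1.mul hf.cy).add (c4.mul h.cy)),
    ((c3.mul (hf.c.sub h.c)).add (continuousOn_const.mul (c2.mul (hf.cy.sub h.cy)))).add
      ((c1.mul hf.cyy).add (c4.mul h.cyy))⟩

theorem jetCL (p q : ℝ) {S : Set (ℝ × ℝ)} (hS : ∀ z ∈ S, z.1 < 0 ∧ 0 < z.2) :
    JetC (fun x y => p * Real.log x + q * Real.log y)
    (fun x y => p * x⁻¹) (fun x y => p * (-(x ^ 2)⁻¹)) (fun x y => q * y⁻¹)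
    (fun x y => q * (-(y ^ 2)⁻¹)) S := by
  have h1 : ∀ z ∈ S, z.1 ≠ 0 := fun z hz => (hS z hz).1.ne
  have h2 : ∀ z ∈ S, z.2 ≠ 0 := fun z hz => (hS z hz).2.ne'
  have h3 : ∀ z ∈ S, z.1 ^ 2 ≠ 0 := fun z hz => pow_ne_zero 2 (h1 z hz)
  have h4 : ∀ z ∈ S, z.2 ^ 2 ≠ 0 := fun z hz => pow_ne_zero 2 (h2 z hz)
  constructor <;> fun_prop (disch := assumption)

theorem jetCP (c D δ q : ℝ) (hD : 0 < D) {S : Set (ℝ × ℝ)} (hS : ∀ z ∈ S, z.1 < 0 ∧ 0 < z.2) :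
    JetC (fun x y => c + δ * Real.log (D * x ^ 2 + y ^ 2) + q * Real.log y)
    (fun x y => δ * (2 * D * x / (D * x ^ 2 + y ^ 2)))
    (fun x y => δ * (2 * D / (D * x ^ 2 + y ^ 2) - (2 * D * x / (D * x ^ 2 + y ^ 2)) ^ 2))
    (fun x y => δ * (2 * y / (D * x ^ 2 + y ^ 2)) + q * y⁻¹)
    (fun x y => δ * (2 / (D * x ^ 2 + y ^ 2) - (2 * y / (D * x ^ 2 + y ^ 2)) ^ 2)
      + q * (-(y ^ 2)⁻¹)) S := by
  have h2 : ∀ z ∈ S, z.2 ≠ 0 := fun z hz => (hS z hz).2.ne'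
  have h4 : ∀ z ∈ S, z.2 ^ 2 ≠ 0 := fun z hz => pow_ne_zero 2 (h2 z hz)
  have h5 : ∀ z ∈ S, D * z.1 ^ 2 + z.2 ^ 2 ≠ 0 := by
    intro z hz
    have := (hS z hz).2
    positivity
  constructor <;> fun_prop (disch := assumption)

theorem deriv_zero_on {f : ℝ → ℝ} (hf : Differentiable ℝ f) {s : Set ℝ} (hs : UniqueDiffOn ℝ s)
    (c : ℝ) (h : ∀ t ∈ s, f t = c) : ∀ t ∈ s, deriv f t = 0 := by
  intro t ht
  have h1 := (hf t).hasDerivAt.hasDerivWithinAt (s := s)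
  have h2 : HasDerivWithinAt f 0 s t :=
    (hasDerivWithinAt_const t s c).congr h (h t ht)
  exact (hs t ht).eq_deriv _ h1 h2

theorem kfacts (k : ℝ → ℝ) (hk : ContDiff ℝ (⊤ : ℕ∞) k)
    (hk0 : ∀ t ≤ (0:ℝ), k t = 0) (hk1 : ∀ t ≥ (1:ℝ), k t = 1)
    (hk' : ∀ t ∈ Set.Ioo (0:ℝ) 1, 0 < deriv k t) :
    Differentiable ℝ k ∧ Differentiable ℝ (deriv k) ∧ Continuous (deriv (deriv k)) ∧
    (∀ t, 0 ≤ k t ∧ k t ≤ 1) ∧ (∀ t ≤ 0, deriv k t = 0 ∧ deriv (deriv k) t = 0) ∧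
    (∀ t ≥ 1, deriv k t = 0 ∧ deriv (deriv k) t = 0) ∧
    ∃ M > 0, ∀ t ∈ Set.Ioo (0:ℝ) 1, deriv k t ≤ M ∧ |deriv (deriv k) t| ≤ M := by
  have d1 : Differentiable ℝ k := hk.differentiable (by simp)
  have hk2 : ContDiff ℝ (⊤ : ℕ∞) (deriv k) := (contDiff_infty_iff_deriv.1 hk).2
  have d2 : Differentiable ℝ (deriv k) := hk2.differentiable (by simp)
  have hk3 : ContDiff ℝ (⊤ : ℕ∞) (deriv (deriv k)) := (contDiff_infty_iff_deriv.1 hk2).2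
  have mono : MonotoneOn k (Set.Icc 0 1) := by
    apply monotoneOn_of_deriv_nonneg (convex_Icc 0 1) d1.continuous.continuousOn d1.differentiableOn
    intro t ht
    rw [interior_Icc] at ht
    exact (hk' t ht).le
  have z0 := deriv_zero_on d1 (uniqueDiffOn_Iic 0) 0 hk0
  have z1 := deriv_zero_on d1 (uniqueDiffOn_Ici 1) 1 hk1
  refine ⟨d1, d2, hk3.continuous, ?_, ?_, ?_, ?_⟩
  · intro t
    rcases le_total t 0 with h | h
    · rw [hk0 t h]; norm_num
    rcases le_total 1 t with h' | h'
    · rw [hk1 t h']; norm_num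
    have e0 := hk0 0 le_rfl
    have e1 := hk1 1 le_rfl
    have m0 := mono (Set.left_mem_Icc.2 zero_le_one) ⟨h, h'⟩ h
    have m1 := mono ⟨h, h'⟩ (Set.right_mem_Icc.2 zero_le_one) h'
    exact ⟨by linarith, by linarith⟩
  · exact fun t ht => ⟨z0 t ht, deriv_zero_on d2 (uniqueDiffOn_Iic 0) 0 z0 t ht⟩
  · exact fun t ht => ⟨z1 t ht, deriv_zero_on d2 (uniqueDiffOn_Ici 1) 0 z1 t ht⟩
  · obtain ⟨M1, hM1⟩ := isCompact_Icc.exists_bound_of_continuousOn (s := Set.Icc (0:ℝ) 1)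
      hk2.continuous.continuousOn
    obtain ⟨M2, hM2⟩ := isCompact_Icc.exists_bound_of_continuousOn (s := Set.Icc (0:ℝ) 1)
      hk3.continuous.continuousOn
    refine ⟨max (max M1 M2) 1, lt_of_lt_of_le one_pos (le_max_right _ _), fun t ht => ⟨?_, ?_⟩⟩
    · exact (le_abs_self _).trans ((hM1 t (Set.Ioo_subset_Icc_self ht)).trans
        ((le_max_left _ _).trans (le_max_left _ _)))
    · exact (hM2 t (Set.Ioo_subset_Icc_self ht)).trans
        ((le_max_right _ _).trans (le_max_left _ _))

theorem midArith (b1 b2 κ₁ κ₂ P Px Pxx Py Pyy H Hx Hxx Hy Hyy r r' r'' c x A M : ℝ)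
    (hκ₂ : 0 < κ₂) (hA : 0 < A) (hM : 0 < M)
    (hr0 : 0 ≤ r) (hr1 : r ≤ 1) (hr'0 : 0 ≤ r') (hr'M : r' ≤ M) (hr'' : |r''| ≤ M)
    (hb2 : 0 ≤ b2) (hP0 : 0 ≤ P) (hPA : P ≤ A) (hAH : A ≤ H) (hHA : H ≤ 2 * A)
    (hPy : |Py| ≤ 2 * A) (hHy : |Hy| ≤ 2 * A)
    (hLP : b1 * Px + b2 * Py + κ₁ * Pxx + κ₂ * Pyy ≤ c * x * A)
    (hLH : b1 * Hx + b2 * Hy + κ₁ * Hxx + κ₂ * Hyy ≤ c * x * A)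
    (hc : 0 < c) (hx : c * x + 10 * κ₂ * M ≤ - 2 * c) :
    b1 * (r * Px + (1 - r) * Hx) + b2 * (r' * (P - H) + (r * Py + (1 - r) * Hy))
      + κ₁ * (r * Pxx + (1 - r) * Hxx)
      + κ₂ * (r'' * (P - H) + 2 * (r' * (Py - Hy)) + (r * Pyy + (1 - r) * Hyy))
      ≤ - c * (r * P + (1 - r) * H) := by
  have e1 := mul_le_mul_of_nonneg_left hLP hr0
  have e2 := mul_le_mul_of_nonneg_left hLH (by linarith : 0 ≤ 1 - r)
  have e3 : b2 * (r' * (H - P)) ≥ 0 := mul_nonneg hb2 (mul_nonneg hr'0 (by linarith))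
  have e4 : r'' * (P - H) ≤ M * (2 * A) := by
    refine (le_abs_self _).trans ?_
    rw [abs_mul]
    apply mul_le_mul hr'' _ (abs_nonneg _) hM.le
    rw [abs_le]; constructor <;> linarith
  have e5 : r' * (Py - Hy) ≤ M * (4 * A) := by
    have := abs_le.1 hPy
    have := abs_le.1 hHy
    refine (mul_le_mul_of_nonneg_left (by linarith : Py - Hy ≤ 4 * A) hr'0).trans ?_
    exact mul_le_mul_of_nonneg_right hr'M (by linarith)
  have e6 := mul_le_mul_of_nonneg_left e4 hκ₂.le
  have e7 := mul_le_mul_of_nonneg_left e5 hκ₂.le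
  have e8 := mul_le_mul_of_nonneg_right hx hA.le
  have e9 : r * P + (1 - r) * H ≤ 2 * A := by
    have := mul_le_mul_of_nonneg_left (by linarith : P ≤ 2 * A) hr0
    have := mul_le_mul_of_nonneg_left hHA (by linarith : 0 ≤ 1 - r)
    linarith
  have e10 := mul_le_mul_of_nonneg_left e9 hc.le
  linarith

noncomputable def eA (σ δ x y : ℝ) : ℝ :=
  Real.exp (2 * δ * Real.log x + -(2 * σ * δ) * Real.log y)

noncomputable def eB (σ δ x y : ℝ) : ℝ :=
  Real.exp (0 * Real.log x + 2 * δ * (1 - σ) * Real.log y)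

noncomputable def eP (C D σ δ x y : ℝ) : ℝ :=
  Real.exp (Real.log C + δ * Real.log (D * x ^ 2 + y ^ 2) + -(2 * σ * δ) * Real.log y)

theorem eB_eq (σ δ x y : ℝ) :
    eB σ δ x y = eA σ δ x y * Real.exp (2 * δ * (Real.log y - Real.log x)) := by
  unfold eA eB
  rw [← Real.exp_add]; congr 1; ring

theorem eB_le (σ δ x y : ℝ) (hδ : 0 < δ) (hy : 0 < y) (hyx : y ≤ -x) : eB σ δ x y ≤ eA σ δ x y := by
  rw [eB_eq]
  apply mul_le_of_le_one_right (Real.exp_pos _).le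
  rw [Real.exp_le_one_iff]
  have : Real.log y ≤ Real.log (-x) := Real.log_le_log hy hyx
  rw [Real.log_neg_eq_log] at this
  exact mul_nonpos_of_nonneg_of_nonpos (by positivity) (by linarith)

theorem logC (C D δ : ℝ) (hD : 0 < D) (hC : C = 1 / (2 * D ^ δ)) :
    Real.log C = - Real.log 2 - δ * Real.log D := by
  rw [hC, one_div, Real.log_inv, Real.log_mul two_ne_zero (Real.rpow_pos_of_pos hD δ).ne',
    Real.log_rpow hD]
  ring

theorem eP_ge (C D σ δ x y : ℝ) (hD : 0 < D) (hC : C = 1 / (2 * D ^ δ)) (hδ : 0 < δ)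
    (hx : x < 0) : eA σ δ x y / 2 ≤ eP C D σ δ x y := by
  have h2 : eA σ δ x y / 2
      = Real.exp (2 * δ * Real.log x + -(2 * σ * δ) * Real.log y - Real.log 2) := by
    rw [Real.exp_sub, Real.exp_log two_pos]; rfl
  rw [h2]; unfold eP
  apply Real.exp_le_exp.2
  rw [logC C D δ hD hC]
  have h3 : Real.log D + 2 * Real.log x ≤ Real.log (D * x ^ 2 + y ^ 2) := by
    have : Real.log D + 2 * Real.log x = Real.log (D * x ^ 2) := by
      rw [Real.log_mul hD.ne' (pow_ne_zero 2 hx.ne), Real.log_pow]; norm_num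
    rw [this]
    have hx2 : 0 < x ^ 2 := by have := hx.ne; positivity
    exact Real.log_le_log (by positivity) (by nlinarith [sq_nonneg y])
  have h4 := mul_le_mul_of_nonneg_left h3 hδ.le
  linarith

theorem eP_le (C D σ δ x y : ℝ) (hD : 1 ≤ D) (hC : C = 1 / (2 * D ^ δ)) (hδ : 0 < δ) (hδ1 : δ ≤ 1)
    (hx : x < 0) (hy : 0 < y) (hyx : y ≤ -x) : eP C D σ δ x y ≤ eA σ δ x y := by
  have hD0 : 0 < D := by linarith
  unfold eP eA
  apply Real.exp_le_exp.2
  rw [logC C D δ hD0 hC]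
  have hx2 : 0 < x ^ 2 := by have := hx.ne; positivity
  have h3 : Real.log (D * x ^ 2 + y ^ 2) ≤ Real.log 2 + (Real.log D + 2 * Real.log x) := by
    have : Real.log 2 + (Real.log D + 2 * Real.log x) = Real.log (2 * (D * x ^ 2)) := by
      rw [Real.log_mul two_ne_zero (by positivity), Real.log_mul hD0.ne' (pow_ne_zero 2 hx.ne),
        Real.log_pow]; norm_num
    rw [this]
    refine Real.log_le_log (by positivity) ?_
    have : y ^ 2 ≤ x ^ 2 := by nlinarith
    nlinarith
  have h4 := mul_le_mul_of_nonneg_left h3 hδ.le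
  have h5 := mul_le_mul_of_nonneg_right hδ1 (Real.log_nonneg (by norm_num : (1:ℝ) ≤ 2))
  linarith

/-- The explicit value of `L` on the patched function. -/
noncomputable def LF (a₁ a₂ α₁ α₂ κ₁ κ₂ σ δ D C : ℝ) (k : ℝ → ℝ) (x y : ℝ) : ℝ :=
  (a₁ * x - α₁ * x ^ 2 + y ^ 2) *
      (k (y - 1) * (eP C D σ δ x y * (δ * (2 * D * x / (D * x ^ 2 + y ^ 2)))) + (1 - k (y - 1)) *
        (eA σ δ x y * (2 * δ * x⁻¹) + eB σ δ x y * (0 * x⁻¹)))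
    + (a₂ * y - α₂ * x * y) * (deriv k (y - 1) * (eP C D σ δ x y - (eA σ δ x y + eB σ δ x y)) +
      (k (y - 1) * (eP C D σ δ x y *
          (δ * (2 * y / (D * x ^ 2 + y ^ 2)) + -(2 * σ * δ) * y⁻¹)) + (1 - k (y - 1)) *
        (eA σ δ x y * (-(2 * σ * δ) * y⁻¹) + eB σ δ x y * (2 * δ * (1 - σ) * y⁻¹))))
    + κ₁ * (k (y - 1) * (eP C D σ δ x y *
          (δ * (2 * D / (D * x ^ 2 + y ^ 2) - (2 * D * x / (D * x ^ 2 + y ^ 2)) ^ 2)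
          + (δ * (2 * D * x / (D * x ^ 2 + y ^ 2))) ^ 2)) + (1 - k (y - 1)) *
        (eA σ δ x y * (2 * δ * (-(x ^ 2)⁻¹) + (2 * δ * x⁻¹) ^ 2)
          + eB σ δ x y * (0 * (-(x ^ 2)⁻¹) + (0 * x⁻¹) ^ 2)))
    + κ₂ * (deriv (deriv k) (y - 1) * (eP C D σ δ x y - (eA σ δ x y + eB σ δ x y)) +
      2 * (deriv k (y - 1) * (eP C D σ δ x y *
          (δ * (2 * y / (D * x ^ 2 + y ^ 2)) + -(2 * σ * δ) * y⁻¹) -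
        (eA σ δ x y * (-(2 * σ * δ) * y⁻¹) + eB σ δ x y * (2 * δ * (1 - σ) * y⁻¹)))) +
      (k (y - 1) * (eP C D σ δ x y *
        (δ * (2 / (D * x ^ 2 + y ^ 2) - (2 * y / (D * x ^ 2 + y ^ 2)) ^ 2)
          + -(2 * σ * δ) * (-(y ^ 2)⁻¹)
          + (δ * (2 * y / (D * x ^ 2 + y ^ 2)) + -(2 * σ * δ) * y⁻¹) ^ 2)) + (1 - k (y - 1)) *
        (eA σ δ x y * (-(2 * σ * δ) * (-(y ^ 2)⁻¹) + (-(2 * σ * δ) * y⁻¹) ^ 2)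
          + eB σ δ x y * (2 * δ * (1 - σ) * (-(y ^ 2)⁻¹) + (2 * δ * (1 - σ) * y⁻¹) ^ 2))))

noncomputable def FF (σ δ D C : ℝ) (k : ℝ → ℝ) (x y : ℝ) : ℝ :=
  k (y - 1) * eP C D σ δ x y + (1 - k (y - 1)) * (eA σ δ x y + eB σ δ x y)

theorem Lop_eq (a₁ a₂ α₁ α₂ κ₁ κ₂ σ δ D C : ℝ) (k : ℝ → ℝ) (hD : 0 < D)
    (d1 : Differentiable ℝ k) (d2 : Differentiable ℝ (deriv k)) {Φ : ℝ × ℝ → ℝ}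
    (hΦ : ∀ x y : ℝ, x < 0 → 0 < y → Φ (x, y) = FF σ δ D C k x y) (x y : ℝ)
    (hx : x < 0) (hy : 0 < y) :
    Lop a₁ a₂ α₁ α₂ κ₁ κ₂ Φ (x, y) = LF a₁ a₂ α₁ α₂ κ₁ κ₂ σ δ D C k x y := by
  have J := Jet.mix (jetP (Real.log C) D δ (-(2 * σ * δ)) hD).exp
    (Jet.add (jetL (2 * δ) (-(2 * σ * δ))).exp (jetL 0 (2 * δ * (1 - σ))).exp)
    (fun y => k (y - 1)) (fun y => deriv k (y - 1)) (fun y => deriv (deriv k) (y - 1))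
    (fun t => (d1 (t - 1)).hasDerivAt.comp_sub_const t 1)
    (fun t => (d2 (t - 1)).hasDerivAt.comp_sub_const t 1)
  exact J.lop hΦ a₁ a₂ α₁ α₂ κ₁ κ₂ x y hx hy

theorem LF_cont (a₁ a₂ α₁ α₂ κ₁ κ₂ σ δ D C : ℝ) (k : ℝ → ℝ) (hD : 0 < D)
    (d1 : Differentiable ℝ k) (d2 : Differentiable ℝ (deriv k)) (c3 : Continuous (deriv (deriv k)))
    {S : Set (ℝ × ℝ)} (hS : ∀ z ∈ S, z.1 < 0 ∧ 0 < z.2) :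
    ContinuousOn (fun p : ℝ × ℝ => LF a₁ a₂ α₁ α₂ κ₁ κ₂ σ δ D C k p.1 p.2) S ∧
    ContinuousOn (fun p : ℝ × ℝ => FF σ δ D C k p.1 p.2) S := by
  have s1 : Continuous (fun y : ℝ => y - 1) := by fun_prop
  have J := JetC.mix (jetCP (Real.log C) D δ (-(2 * σ * δ)) hD hS).exp
    (JetC.add (jetCL (2 * δ) (-(2 * σ * δ)) hS).exp (jetCL 0 (2 * δ * (1 - σ)) hS).exp)
    (fun y => k (y - 1)) (fun y => deriv k (y - 1)) (fun y => deriv (deriv k) (y - 1))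
    (d1.continuous.comp s1) (d2.continuous.comp s1) (c3.comp s1)
  have b1 : ContinuousOn (fun p : ℝ × ℝ => a₁ * p.1 - α₁ * p.1 ^ 2 + p.2 ^ 2) S := by fun_prop
  have b2 : ContinuousOn (fun p : ℝ × ℝ => a₂ * p.2 - α₂ * p.1 * p.2) S := by fun_prop
  exact ⟨(((b1.mul J.cx).add (b2.mul J.cy)).add (continuousOn_const.mul J.cxx)).add
    (continuousOn_const.mul J.cyy), J.c⟩

set_option maxHeartbeats 1000000 in
theorem far (a₁ a₂ α₁ α₂ κ₁ κ₂ σ δ D C : ℝ) (hα₂ : 0 < α₂) (hα : α₁ < α₂)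
    (hσ0 : 0 < σ) (hσ1 : σ < 1) (hσα : 2 * σ * α₂ = α₁ + α₂)
    (hδ0 : 0 < δ) (hδ1 : δ < 1 / 2) (hκ₂ : 0 < κ₂) (hκ₁ : 0 ≤ κ₁)
    (hneg : (α₁ - σ * α₂) + κ₂ * σ * (2 * σ * δ + 1) < 0)
    (hD : D = 1 + (α₂ - α₁) + 4 * |a₂| * (1 - σ)) (hC : C = 1 / (2 * D ^ δ))
    (k : ℝ → ℝ) (hk0 : ∀ t ≤ (0:ℝ), k t = 0) (hk1 : ∀ t ≥ (1:ℝ), k t = 1)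
    (hk' : ∀ t ∈ Set.Ioo (0:ℝ) 1, 0 < deriv k t)
    (hk01 : ∀ t, 0 ≤ k t ∧ k t ≤ 1) (hd0 : ∀ t ≤ 0, deriv k t = 0 ∧ deriv (deriv k) t = 0)
    (hd1 : ∀ t ≥ 1, deriv k t = 0 ∧ deriv (deriv k) t = 0)
    (M : ℝ) (hM : 0 < M)
    (hkM : ∀ t ∈ Set.Ioo (0:ℝ) 1, deriv k t ≤ M ∧ |deriv (deriv k) t| ≤ M) :
    ∃ c > 0, ∃ R ≥ 2, ∀ x y : ℝ, 0 < y →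
      ((x < -2 ∧ (y ^ 2)⁻¹ < -x ∧ y < 2) ∨ (x < -1/2 ∧ 1 < y)) → (x < -R ∨ R < y) →
      LF a₁ a₂ α₁ α₂ κ₁ κ₂ σ δ D C k x y ≤ - c * FF σ δ D C k x y := by
  have hD1 : 1 ≤ D := by
    have : 0 ≤ 4 * |a₂| * (1 - σ) := mul_nonneg (by positivity) (by linarith)
    linarith
  have hσδ : 2 * σ * δ ≤ 1 := by nlinarith
  have hσδ' : 2 * δ * (1 - σ) ≤ 1 := mul_le_one₀ (by linarith) (by linarith) (by linarith)
  have hσδ'0 : 0 ≤ 2 * δ * (1 - σ) := mul_nonneg (by linarith) (by linarith)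
  obtain ⟨cP, hcP, RP, hRP, HP⟩ := estP a₁ a₂ α₁ α₂ κ₁ κ₂ σ δ D hα hσ0 hσ1 hσα hδ0 hδ1 hκ₂ hκ₁ hD
  obtain ⟨cA, hcA, RA, hRA, HA⟩ := estA a₁ a₂ α₁ α₂ κ₁ κ₂ σ δ hα₂ hσ0 hσ1 hδ0 hδ1 hκ₂ hκ₁ hneg
  set c := min cA (cP / 2) with hc
  have hc0 : 0 < c := lt_min hcA (by linarith)
  have hcA' : c ≤ cA := min_le_left _ _
  have hcP' : c ≤ cP / 2 := min_le_right _ _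
  set R := RP + RA + |a₂| / α₂ + (10 * κ₂ * M + 2 * c) / c with hR
  have q1 : 0 ≤ |a₂| / α₂ := by positivity
  have q2 : 0 ≤ (10 * κ₂ * M + 2 * c) / c := by positivity
  refine ⟨c, hc0, R, by linarith, ?_⟩
  intro x y hy hU hfar
  have hx : x < -1/2 := by rcases hU with h | h <;> linarith [h.1]
  have hx0 : x < 0 := by linarith
  have pA : 0 < eA σ δ x y := Real.exp_pos _
  have pB : 0 < eB σ δ x y := Real.exp_pos _
  have pP : 0 < eP C D σ δ x y := Real.exp_pos _
  have hBe := eB_eq σ δ x y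
  unfold LF FF
  rcases le_or_gt y 1 with hy1 | hy1
  · -- near the axis
    have hxR : x < -R := by rcases hfar with h | h <;> linarith
    have hU' : x < -2 ∧ (y ^ 2)⁻¹ < -x ∧ y < 2 := by
      rcases hU with h | h
      · exact h
      · linarith [h.2]
    have hL := HA x y _ _ (by linarith) hy hU'.2.2 hU'.2.1 pA pB hBe
    have hBA := eB_le σ δ x y hδ0 hy (by linarith)
    rw [hk0 (y - 1) (by linarith), (hd0 (y - 1) (by linarith)).1, (hd0 (y - 1) (by linarith)).2]
    simp only [zero_mul, sub_zero, one_mul, zero_add, mul_zero] at hL ⊢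
    refine hL.trans ?_
    have f1 : cA * x ≤ - 2 * c := by
      have := mul_le_mul_of_nonneg_left hU'.1.le hcA.le
      linarith
    have f2 := mul_le_mul_of_nonneg_right f1 pA.le
    have f3 := mul_le_mul_of_nonneg_left hBA hc0.le
    linarith
  rcases le_or_gt 2 y with hy2 | hy2
  · have hL := HP x y hx hy1 (by rcases hfar with h | h <;> [left; right] <;> linarith)
    rw [hk1 (y - 1) (by linarith), (hd1 (y - 1) (by linarith)).1, (hd1 (y - 1) (by linarith)).2]
    have f1 := mul_le_mul_of_nonneg_left hL pP.le
    simp only [zero_mul, sub_self, one_mul, zero_add, mul_zero, add_zero] at f1 ⊢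
    have f2 : cP * x ≤ - c := by
      have := mul_le_mul_of_nonneg_left hx.le hcP.le
      linarith
    have f3 := mul_le_mul_of_nonneg_left f2 pP.le
    refine le_trans (le_of_eq ?_) (f1.trans (f3.trans (le_of_eq ?_))) <;> ring
  · have hxR : x < -R := by rcases hfar with h | h <;> linarith
    have ht : y - 1 ∈ Set.Ioo (0:ℝ) 1 := ⟨by linarith, by linarith⟩
    have hyx : y ≤ -x := by linarith
    have hyi : (y ^ 2)⁻¹ ≤ 1 := inv_le_one_of_one_le₀ (one_le_pow₀ hy1.le)
    have hLA := HA x y _ _ (by linarith) hy hy2 (by linarith) pA pB hBe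
    have hLP := HP x y hx hy1 (by left; linarith)
    have hBA := eB_le σ δ x y hδ0 hy hyx
    have hP1 := eP_ge C D σ δ x y (by linarith) hC hδ0 hx0
    have hP2 := eP_le C D σ δ x y hD1 hC hδ0 (by linarith) hx0 hy hyx
    have hyi0 : 0 < y⁻¹ := by positivity
    have hyi1 : y⁻¹ ≤ 1 := inv_le_one_of_one_le₀ hy1.le
    apply midArith (A := eA σ δ x y) (M := M) (x := x) (hκ₂ := hκ₂) (hA := pA) (hM := hM)
      (hr0 := (hk01 _).1) (hr1 := (hk01 _).2) (hr'0 := (hk' _ ht).le) (hr'M := (hkM _ ht).1)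
      (hr'' := (hkM _ ht).2) (hP0 := pP.le) (hPA := hP2) (hc := hc0)
    · have f1 : |a₂| ≤ -x * α₂ := by
        rw [← div_le_iff₀ hα₂]; linarith
      have f2 := neg_abs_le a₂
      have : a₂ * y - α₂ * x * y = (a₂ + -x * α₂) * y := by ring
      rw [this]
      exact mul_nonneg (by linarith) hy.le
    · linarith
    · linarith
    · rw [abs_mul, abs_of_pos pP, mul_comm]
      apply mul_le_mul _ hP2 pP.le (by norm_num)
      have hQ : 0 < D * x ^ 2 + y ^ 2 := by positivity
      have g1 : 2 * y / (D * x ^ 2 + y ^ 2) ≤ 2 := by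
        rw [div_le_iff₀ hQ]
        have h1 : 0 ≤ D * x ^ 2 := by positivity
        have h2 : y ≤ y ^ 2 := le_self_pow₀ hy1.le two_ne_zero
        linarith
      have g0 : 0 ≤ 2 * y / (D * x ^ 2 + y ^ 2) := by positivity
      have g2 : δ * (2 * y / (D * x ^ 2 + y ^ 2)) ≤ 1 / 2 * 2 :=
        mul_le_mul hδ1.le g1 g0 (by norm_num)
      have g3 : 0 ≤ δ * (2 * y / (D * x ^ 2 + y ^ 2)) := by positivity
      have g4 : 2 * σ * δ * y⁻¹ ≤ 1 := mul_le_one₀ hσδ hyi0.le hyi1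
      have g5 : 0 ≤ 2 * σ * δ * y⁻¹ := by positivity
      rw [abs_le]; constructor <;> linarith
    · have g4 : 2 * σ * δ * y⁻¹ ≤ 1 := mul_le_one₀ hσδ hyi0.le hyi1
      have g5 : 0 ≤ 2 * σ * δ * y⁻¹ := by positivity
      have g6 : 2 * δ * (1 - σ) * y⁻¹ ≤ 1 := mul_le_one₀ hσδ' hyi0.le hyi1
      have g7 : 0 ≤ 2 * δ * (1 - σ) * y⁻¹ := mul_nonneg hσδ'0 hyi0.le
      have g8 := mul_le_mul_of_nonneg_left g4 pA.le
      have g9 := mul_le_mul_of_nonneg_left g6 pB.le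
      have g10 := mul_nonneg pA.le g5
      have g11 := mul_nonneg pB.le g7
      rw [neg_mul]
      rw [abs_le]; constructor <;> linarith
    · have f1 := mul_le_mul_of_nonneg_left hLP pP.le
      have f2 : eP C D σ δ x y * (cP * x) ≤ c * x * eA σ δ x y := by
        have h1 : (-x) * cP * (eA σ δ x y / 2) ≤ (-x) * cP * eP C D σ δ x y :=
          mul_le_mul_of_nonneg_left hP1 (mul_nonneg (by linarith) hcP.le)
        have h2 : c * (-x * eA σ δ x y) ≤ cP / 2 * (-x * eA σ δ x y) :=
          mul_le_mul_of_nonneg_right hcP' (mul_nonneg (by linarith) pA.le)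
        linarith
      refine le_trans (le_of_eq ?_) (f1.trans f2)
      ring
    · refine hLA.trans ?_
      have h2 : c * (-x * eA σ δ x y) ≤ cA * (-x * eA σ δ x y) :=
          mul_le_mul_of_nonneg_right hcA' (mul_nonneg (by linarith) pA.le)
      linarith
    · have f1 : (10 * κ₂ * M + 2 * c) / c ≤ -x := by linarith
      rw [div_le_iff₀ hc0] at f1
      linarith

theorem phi23_eq (k : ℝ → ℝ) (C D σ δ : ℝ) (hk0 : ∀ t ≤ (0:ℝ), k t = 0)
    (hk1 : ∀ t ≥ (1:ℝ), k t = 1) (p : ℝ × ℝ) :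
    phi23 k C D σ δ p = k (|p.2| - 1) * phi3 C D σ δ p + (1 - k (|p.2| - 1)) * phi2 σ δ p := by
  unfold phi23
  split_ifs with h1 h2
  · rw [hk0 _ (by linarith)]; ring
  · rw [hk1 _ (by linarith)]; ring
  · rfl

theorem phi2_eq (σ δ x y : ℝ) (hx : x < 0) (hy : 0 < y) :
    phi2 σ δ (x, y) = eA σ δ x y + eB σ δ x y := by
  simp only [phi2, eA, eB]
  rw [abs_of_neg hx, abs_of_pos hy, Real.rpow_def_of_pos (neg_pos.2 hx), Real.rpow_def_of_pos hy,
    Real.rpow_def_of_pos hy, Real.log_neg_eq_log, one_mul, add_div, ← Real.exp_sub, ← Real.exp_sub]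
  congr 2 <;> ring

theorem phi3_eq (C D σ δ x y : ℝ) (hC : 0 < C) (hD : 0 < D) (hy : 0 < y) :
    phi3 C D σ δ (x, y) = eP C D σ δ x y := by
  simp only [phi3, eP]
  have hQ : 0 < D * x ^ 2 + y ^ 2 := by positivity
  have hY : 0 < y ^ (2 * σ) := Real.rpow_pos_of_pos hy _
  rw [abs_of_pos hy, Real.rpow_def_of_pos (div_pos hQ hY), Real.log_div hQ.ne' hY.ne',
    Real.log_rpow hy]
  conv_lhs => rw [← Real.exp_log hC]
  rw [← Real.exp_add]
  congr 1; ring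

theorem phi23_smooth (k : ℝ → ℝ) (C D σ δ : ℝ) (hD : 0 < D) (hk : ContDiff ℝ (⊤ : ℕ∞) k)
    (hk0 : ∀ t ≤ (0:ℝ), k t = 0) (hk1 : ∀ t ≥ (1:ℝ), k t = 1) {S : Set (ℝ × ℝ)}
    (hS : ∀ z ∈ S, z.1 ≠ 0 ∧ z.2 ≠ 0) : ContDiffOn ℝ (⊤ : ℕ∞) (phi23 k C D σ δ) S := by
  have e : phi23 k C D σ δ = fun p => k (|p.2| - 1) * phi3 C D σ δ p
      + (1 - k (|p.2| - 1)) * phi2 σ δ p := funext (phi23_eq k C D σ δ hk0 hk1)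
  rw [e]
  intro p hp
  apply ContDiffAt.contDiffWithinAt
  obtain ⟨h1, h2⟩ := hS p hp
  have a1 : ContDiffAt ℝ (⊤ : ℕ∞) (fun p : ℝ × ℝ => |p.1|) p :=
    (contDiffAt_abs h1).comp p contDiffAt_fst
  have a2 : ContDiffAt ℝ (⊤ : ℕ∞) (fun p : ℝ × ℝ => |p.2|) p :=
    (contDiffAt_abs h2).comp p contDiffAt_snd
  have h1' : |p.1| ≠ 0 := abs_ne_zero.2 h1
  have h2' : |p.2| ≠ 0 := abs_ne_zero.2 h2
  have r : ContDiffAt ℝ (⊤ : ℕ∞) (fun p : ℝ × ℝ => k (|p.2| - 1)) p :=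
    hk.contDiffAt.comp p (a2.sub contDiffAt_const)
  have P2 : ContDiffAt ℝ (⊤ : ℕ∞) (phi2 σ δ) p := by
    unfold phi2
    refine contDiffAt_const.mul (((a1.rpow_const_of_ne h1').add (a2.rpow_const_of_ne h2')).div
      (a2.rpow_const_of_ne h2') ?_)
    exact (Real.rpow_pos_of_pos (abs_pos.2 h2) _).ne'
  have P3 : ContDiffAt ℝ (⊤ : ℕ∞) (phi3 C D σ δ) p := by
    unfold phi3
    have hY : 0 < |p.2| ^ (2 * σ) := Real.rpow_pos_of_pos (abs_pos.2 h2) _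
    have hQ : 0 < D * p.1 ^ 2 + p.2 ^ 2 := by positivity
    refine contDiffAt_const.mul (ContDiffAt.rpow_const_of_ne (ContDiffAt.div ?_
      (a2.rpow_const_of_ne h2') hY.ne') (div_pos hQ hY).ne')
    fun_prop
  exact (r.mul P3).add ((contDiffAt_const.sub r).mul P2)

theorem Lop_even (a₁ a₂ α₁ α₂ κ₁ κ₂ : ℝ) (Φ : ℝ × ℝ → ℝ) (hΦ : ∀ x y, Φ (x, -y) = Φ (x, y))
    (x y : ℝ) : Lop a₁ a₂ α₁ α₂ κ₁ κ₂ Φ (x, -y) = Lop a₁ a₂ α₁ α₂ κ₁ κ₂ Φ (x, y) := by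
  have e1 : ∀ t, deriv (fun t => Φ (x, t)) (-t) = - deriv (fun t => Φ (x, t)) t := by
    intro t
    have := deriv_comp_neg (fun t => Φ (x, t)) t
    simp only [hΦ] at this
    linarith
  have e2 : deriv (deriv (fun t => Φ (x, t))) (-y) = deriv (deriv (fun t => Φ (x, t))) y := by
    have := deriv_comp_neg (deriv (fun t => Φ (x, t))) y
    simp only [e1] at this
    have h2 : deriv (fun t => - deriv (fun t => Φ (x, t)) t) y
        = - deriv (deriv (fun t => Φ (x, t))) y := deriv.fun_neg
    linarith
  simp only [Lop, hΦ, e1, e2]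
  ring

theorem FF_ge (C D σ δ : ℝ) (k : ℝ → ℝ) (hC : 0 < C) (hC1 : C ≤ 1) (hD : 1 ≤ D) (hδ : 0 < δ)
    (hσ0 : 0 < σ) (hσ1 : σ < 1) (hk01 : ∀ t, 0 ≤ k t ∧ k t ≤ 1) (x y n : ℝ) (hx : x < 0) (hy : 0 < y)
    (hn : n = max |x| |y|) : C * Real.exp (2 * δ * (1 - σ) * Real.log n) ≤ FF σ δ D C k x y := by
  have hyn : |y| ≤ n := hn ▸ le_max_right _ _
  have hxn : |x| ≤ n := hn ▸ le_max_left _ _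
  rw [abs_of_pos hy] at hyn
  have hn0 : 0 < n := by linarith
  have hly : Real.log y ≤ Real.log n := Real.log_le_log hy hyn
  have hσδ : 0 ≤ 2 * σ * δ := by positivity
  have f1 := mul_le_mul_of_nonneg_left hly hσδ
  have pA : 0 < eA σ δ x y := Real.exp_pos _
  have pB : 0 < eB σ δ x y := Real.exp_pos _
  have hP : C * Real.exp (2 * δ * (1 - σ) * Real.log n) ≤ eP C D σ δ x y := by
    conv_lhs => rw [← Real.exp_log hC]
    rw [← Real.exp_add]
    apply Real.exp_le_exp.2
    have h3 : 2 * Real.log n ≤ Real.log (D * x ^ 2 + y ^ 2) := by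
      have : 2 * Real.log n = Real.log (n ^ 2) := by rw [Real.log_pow]; norm_num
      rw [this]
      apply Real.log_le_log (by positivity)
      have hx2 := mul_le_mul_of_nonneg_right hD (sq_nonneg x)
      rcases max_choice |x| |y| with h | h <;> rw [hn, h, sq_abs] <;> nlinarith [sq_nonneg x, sq_nonneg y]
    have h4 := mul_le_mul_of_nonneg_left h3 hδ.le
    linarith
  have hE : C * Real.exp (2 * δ * (1 - σ) * Real.log n) ≤ Real.exp (2 * δ * (1 - σ) * Real.log n) :=
    mul_le_of_le_one_left (Real.exp_pos _).le hC1
  have h2 : Real.exp (2 * δ * (1 - σ) * Real.log n) ≤ eA σ δ x y + eB σ δ x y := by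
    rcases max_choice |x| |y| with h | h
    · have e : Real.log n = Real.log x := by rw [hn, h, Real.log_abs]
      have : Real.exp (2 * δ * (1 - σ) * Real.log n) ≤ eA σ δ x y := by
        apply Real.exp_le_exp.2
        rw [← e]; linarith
      linarith
    · have e : Real.log n = Real.log y := by rw [hn, h, Real.log_abs]
      have : Real.exp (2 * δ * (1 - σ) * Real.log n) ≤ eB σ δ x y := by
        apply Real.exp_le_exp.2
        rw [← e]; linarith
      linarith
  obtain ⟨k0, k1⟩ := hk01 (y - 1)
  have g1 := mul_le_mul_of_nonneg_left hP k0
  have g2 := mul_le_mul_of_nonneg_left (hE.trans h2) (by linarith : 0 ≤ 1 - k (y - 1))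
  unfold FF
  linarith

theorem statement8 (a₁ a₂ α₁ α₂ κ₁ κ₂ σ δ Dc C₃ : ℝ)
    (hα₁ : 0 < α₁) (hα : α₁ < α₂)
    (hσ : σ = (α₁ + α₂) / (2 * α₂)) (hδ : δ = κ₂ / (8 * α₁))
    (hκ₂ : 0 < κ₂) (hκ₂' : κ₂ < 4 * α₁)
    (hneg : (α₁ - σ * α₂) + κ₂ * σ * (2 * σ * δ + 1) < 0) (hκ₁ : 0 ≤ κ₁)
    (hDc : Dc = 1 + (α₂ + 2 * |a₂|) * (α₂ - α₁) / α₂) (hC₃ : C₃ = 1 / (2 * Dc ^ δ))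
    (k : ℝ → ℝ) (hk : ContDiff ℝ (⊤ : ℕ∞) k)
    (hk0 : ∀ t ≤ (0:ℝ), k t = 0) (hk1 : ∀ t ≥ (1:ℝ), k t = 1)
    (hk' : ∀ t ∈ Set.Ioo (0:ℝ) 1, 0 < deriv k t) :
    IsLyapunovOn a₁ a₂ α₁ α₂ κ₁ κ₂ (phi23 k C₃ Dc σ δ) (U2 ∪ U3) := by
  have hα₂ : 0 < α₂ := by linarith
  have hσα : 2 * σ * α₂ = α₁ + α₂ := by rw [hσ]; field_simp
  have hσ0 : 0 < σ := by rw [hσ]; positivity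
  have hσ1 : σ < 1 := by rw [hσ, div_lt_one (by positivity)]; linarith
  have hδ0 : 0 < δ := by rw [hδ]; positivity
  have hδ1 : δ < 1 / 2 := by rw [hδ, div_lt_iff₀ (by positivity)]; linarith
  have hD : Dc = 1 + (α₂ - α₁) + 4 * |a₂| * (1 - σ) := by
    rw [hDc, hσ]; field_simp; ring
  have hD1 : 1 ≤ Dc := by
    have : 0 ≤ 4 * |a₂| * (1 - σ) := mul_nonneg (by positivity) (by linarith)
    linarith
  have hD0 : 0 < Dc := by linarith
  have hDδ : 1 ≤ Dc ^ δ := Real.one_le_rpow hD1 hδ0.le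
  have hC0 : 0 < C₃ := by rw [hC₃]; positivity
  have hC1 : C₃ ≤ 1 := by rw [hC₃, div_le_one (by positivity)]; linarith
  obtain ⟨d1, d2, c3, hk01, hd0, hd1, M, hM, hkM⟩ := kfacts k hk hk0 hk1 hk'
  -- geometry of the region
  have hU : ∀ x y : ℝ, (x, y) ∈ U2 ∪ U3 → x < 0 ∧ 0 < |y| ∧
      ((x < -2 ∧ (|y| ^ 2)⁻¹ < -x ∧ |y| < 2) ∨ (x < -1/2 ∧ 1 < |y|)) := by
    intro x y h
    rcases h with h | h
    · obtain ⟨h1, h2, h3⟩ := h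
      dsimp only at h1 h2 h3
      have hx : 0 < -x := by linarith
      rw [abs_of_neg (by linarith)] at h2
      have h4 : 0 < (-x) ^ (-(1:ℝ)/2) := Real.rpow_pos_of_pos hx _
      have h5 : 0 < |y| := h4.trans h2
      refine ⟨by linarith, h5, Or.inl ⟨h1, ?_, h3⟩⟩
      have h6 : ((-x) ^ (-(1:ℝ)/2)) ^ 2 = (-x)⁻¹ := by
        rw [← Real.rpow_natCast, ← Real.rpow_mul hx.le, ← Real.rpow_neg_one]
        norm_num
      have h7 : (-x)⁻¹ < |y| ^ 2 := by
        rw [← h6]; exact pow_lt_pow_left₀ h2 h4.le two_ne_zero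
      exact inv_lt_of_inv_lt₀ hx h7
    · obtain ⟨h1, h2⟩ := h
      dsimp only at h1 h2
      exact ⟨by linarith, by linarith, Or.inr ⟨h1, h2⟩⟩
  have hF : ∀ x y : ℝ, x < 0 → 0 < y → phi23 k C₃ Dc σ δ (x, y) = FF σ δ Dc C₃ k x y := by
    intro x y hx hy
    rw [phi23_eq k C₃ Dc σ δ hk0 hk1, phi2_eq σ δ x y hx hy, phi3_eq C₃ Dc σ δ x y hC0 hD0 hy]
    simp only [abs_of_pos hy]
    rfl
  have hev : ∀ x y, phi23 k C₃ Dc σ δ (x, -y) = phi23 k C₃ Dc σ δ (x, y) := by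
    intro x y
    simp only [phi23, phi2, phi3, abs_neg, neg_sq]
  have hFabs : ∀ x y : ℝ, x < 0 → 0 < |y| → phi23 k C₃ Dc σ δ (x, y) = FF σ δ Dc C₃ k x |y| := by
    intro x y hx hy
    rw [← hF x |y| hx hy]
    rcases abs_choice y with h | h <;> rw [h]
    rw [hev]
  have hLabs : ∀ x y : ℝ, x < 0 → 0 < |y| →
      Lop a₁ a₂ α₁ α₂ κ₁ κ₂ (phi23 k C₃ Dc σ δ) (x, y)
        = LF a₁ a₂ α₁ α₂ κ₁ κ₂ σ δ Dc C₃ k x |y| := by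
    intro x y hx hy
    rw [← Lop_eq a₁ a₂ α₁ α₂ κ₁ κ₂ σ δ Dc C₃ k hD0 d1 d2 hF x |y| hx hy]
    rcases abs_choice y with h | h <;> rw [h]
    rw [Lop_even _ _ _ _ _ _ _ hev]
  refine ⟨?_, ?_, ?_⟩
  · apply phi23_smooth k C₃ Dc σ δ hD0 hk hk0 hk1
    rintro ⟨x, y⟩ hz
    obtain ⟨h1, h2, -⟩ := hU x y hz
    exact ⟨h1.ne, abs_pos.1 h2⟩
  · intro m
    set s := 2 * δ * (1 - σ) with hs
    have hs0 : 0 < s := mul_pos (by linarith) (by linarith)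
    have hq : 0 < (|m| + 1) / C₃ := by positivity
    refine ⟨Real.exp (Real.log ((|m| + 1) / C₃) / s), ?_⟩
    rintro ⟨x, y⟩ hz hR
    obtain ⟨h1, h2, -⟩ := hU x y hz
    rw [hFabs x y h1 h2]
    set n := max |x| |(|y|)| with hn
    have hnorm : ‖((x, y) : ℝ × ℝ)‖ = n := by
      rw [hn, abs_abs, Prod.norm_def, Real.norm_eq_abs, Real.norm_eq_abs]
    have hge := FF_ge C₃ Dc σ δ k hC0 hC1 hD1 hδ0 hσ0 hσ1 hk01 x |y| n h1 h2 hn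
    rw [hnorm] at hR
    have hn0 : 0 < n := (Real.exp_pos _).trans hR
    have h3 := (Real.lt_log_iff_exp_lt hn0).2 hR
    rw [div_lt_iff₀ hs0] at h3
    have h4 : (|m| + 1) / C₃ < Real.exp (s * Real.log n) := by
      rw [← Real.log_lt_iff_lt_exp hq]; linarith
    rw [div_lt_iff₀ hC0] at h4
    have := le_abs_self m
    linarith
  · obtain ⟨c, hc, R, hR, hfar⟩ := far a₁ a₂ α₁ α₂ κ₁ κ₂ σ δ Dc C₃ hα₂ hα hσ0 hσ1 hσα hδ0 hδ1 hκ₂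
      hκ₁ hneg hD hC₃ k hk0 hk1 hk' hk01 hd0 hd1 M hM hkM
    have hR0 : 0 < R := by linarith
    set S : Set (ℝ × ℝ) := Set.Icc (-R) (-1/2) ×ˢ Set.Icc R⁻¹ R with hSdef
    have hS : ∀ z ∈ S, z.1 < 0 ∧ 0 < z.2 := by
      rintro ⟨x, y⟩ ⟨h1, h2⟩
      have : 0 < R⁻¹ := by positivity
      exact ⟨by linarith [h1.2], by linarith [h2.1]⟩
    obtain ⟨C1, C2⟩ := LF_cont a₁ a₂ α₁ α₂ κ₁ κ₂ σ δ Dc C₃ k hD0 d1 d2 c3 hS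
    obtain ⟨B, hB⟩ := (isCompact_Icc.prod isCompact_Icc : IsCompact S).exists_bound_of_continuousOn
      (C1.add (continuousOn_const (c := c) |>.mul C2))
    refine ⟨c, hc, |B| + 1, by positivity, ?_⟩
    rintro ⟨x, y⟩ hz
    obtain ⟨h1, h2, h3⟩ := hU x y hz
    rw [hFabs x y h1 h2, hLabs x y h1 h2]
    by_cases hcase : x < -R ∨ R < |y|
    · have := hfar x |y| h2 h3 hcase
      have := abs_nonneg B
      linarith
    · push Not at hcase
      have hmem : (x, |y|) ∈ S := by
        refine ⟨⟨hcase.1, ?_⟩, ?_, hcase.2⟩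
        · dsimp only
          rcases h3 with h | h <;> linarith [h.1]
        · dsimp only
          have hRi : R⁻¹ ≤ 1 := inv_le_one_of_one_le₀ (by linarith)
          rcases le_total 1 |y| with h | h
          · linarith
          rcases h3 with h3 | h3
          · have h4 : (|y| ^ 2)⁻¹ ≤ R := by linarith [h3.2.1, hcase.1]
            have h5 : R⁻¹ ≤ |y| ^ 2 := inv_le_of_inv_le₀ (by positivity) h4
            have h6 : |y| ^ 2 ≤ |y| := pow_le_of_le_one h2.le h two_ne_zero
            linarith
          · linarith [h3.2]
      have h4 := (le_abs_self _).trans (hB _ hmem)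
      have h5 := le_abs_self B
      simp only [Pi.add_apply, Pi.mul_apply] at h4
      linarith
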